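/- Reduction theorem, part 1: Let G be a dense state graph for a barrier-free program P and u0 a node with finitely many reachable nodes. If there is an execution from state(u0) with a data race, then there is a path β in G from u0 such that the execution defined by β has a data race. -/

import Mathlib

namespace MC

/-- Statements of a thread: acquire/release a lock, barrier exit, or an nsync statement. -/
inductive Stmt (Lock NStmt : Type) where
  | acquire : Lock → Stmt Lock NStmt
  | release : Lock → Stmt Lock NStmt
  | exit : Stmt Lock NStmt
  | nsync : NStmt → Stmt Lock NStmt

/-- The kind of a local state: acquire state (with its lock), release state,
barrier state, nsync state, or terminal state. -/
inductive LKind (Lock : Type) where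
  | acquire : Lock → LKind Lock
  | release : Lock → LKind Lock
  | barrier : LKind Lock
  | nsync : LKind Lock
  | term : LKind Lock

def LKind.isBarrier {L : Type} : LKind L → Bool
  | .barrier => true
  | _ => false

def LKind.isTerm {L : Type} : LKind L → Bool
  | .term => true
  | _ => false

/-- A multithreaded program with thread ID set `Fin n`. -/
structure Program where
  n : ℕ
  npos : 0 < n
  Lock : Type
  Shared : Type
  Local : Fin n → Type
  NStmt : Fin n → Type
  kind : ∀ i, Local i → LKind Lock
  next : ∀ i, Local i → Local i
  stmts : ∀ i, Local i → Set (NStmt i)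
  stmtsNonempty : ∀ i σ, kind i σ = .nsync → (stmts i σ).Nonempty
  update : ∀ i, Local i → NStmt i → Shared → Local i × Shared

variable {P : Program}

/-- Global statements: a thread ID together with one of its statements. -/
abbrev GStmt (P : Program) := Σ i : Fin P.n, Stmt P.Lock (P.NStmt i)

def GStmt.isNsync (t : GStmt P) : Prop := ∃ m, t.2 = Stmt.nsync m
def GStmt.isExit (t : GStmt P) : Prop := t.2 = Stmt.exit
def GStmt.isExitZero (t : GStmt P) : Prop := t.2 = Stmt.exit ∧ (t.1 : ℕ) = 0
def GStmt.isReleaseOn (t : GStmt P) (l : P.Lock) : Prop := t.2 = Stmt.release l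
def GStmt.isAcquireOn (t : GStmt P) (l : P.Lock) : Prop := t.2 = Stmt.acquire l

/-- A global state: local state of each thread, shared state, lock state
(`none` = free), and barrier wait set. -/
structure GState (P : Program) where
  loc : ∀ i, P.Local i
  sh : P.Shared
  lk : P.Lock → Option (Fin P.n)
  wait : Set (Fin P.n)

/-- Enabledness of a statement at a global state. -/
def Enabled (s : GState P) : GStmt P → Prop
  | ⟨i, st⟩ =>
    match P.kind i (s.loc i), st with
    | .acquire l, .acquire l' => l = l' ∧ s.lk l = none
    | .release l, .release l' => l = l' ∧ s.lk l = some i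
    | .barrier, .exit => i ∉ s.wait
    | .nsync, .nsync m => m ∈ P.stmts i (s.loc i)
    | _, _ => False

open Classical in
/-- Execution of a statement at a global state. -/
noncomputable def execute (s : GState P) : GStmt P → GState P
  | ⟨i, st⟩ =>
    let r : P.Local i × P.Shared × (P.Lock → Option (Fin P.n)) :=
      match st with
      | .acquire l => (P.next i (s.loc i), s.sh, fun l' => if l' = l then some i else s.lk l')
      | .release l => (P.next i (s.loc i), s.sh, fun l' => if l' = l then none else s.lk l')
      | .exit => (P.next i (s.loc i), s.sh, s.lk)
      | .nsync m => ((P.update i (s.loc i) m s.sh).1, (P.update i (s.loc i) m s.sh).2, s.lk)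
    { loc := Function.update s.loc i r.1
      sh := r.2.1
      lk := r.2.2
      wait :=
        if (P.kind i r.1).isBarrier then
          (if s.wait ∪ {i} = Set.univ then (∅ : Set (Fin P.n)) else s.wait ∪ {i})
        else s.wait }

/-- Finite executions: `Exec s ts sf` means the statement sequence `ts` is
step-by-step enabled starting from `s` and leads to `sf`. -/
inductive Exec : GState P → List (GStmt P) → GState P → Prop
  | nil (s : GState P) : Exec s [] s
  | cons {s s' sf : GState P} {t : GStmt P} {l : List (GStmt P)} :
      Enabled s t → execute s t = s' → Exec s' l sf → Exec s (t :: l) sf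

/-- The program has no barrier local states. -/
def NoBarriers (P : Program) : Prop := ∀ i σ, P.kind i σ ≠ LKind.barrier

/-! ### Traces, events, happens-before, data races -/

/-- The thread ID of the event at position `k` of a trace (if any). -/
def tidAt (ts : List (GStmt P)) (k : ℕ) : Option (Fin P.n) := (ts[k]?).map (·.1)

/-- The statement at position `k` satisfies `p`. -/
def stmtIs (ts : List (GStmt P)) (k : ℕ) (p : GStmt P → Prop) : Prop :=
  ∃ t, ts[k]? = some t ∧ p t

/-- Intra-thread order on trace positions. -/
def IntraThread (ts : List (GStmt P)) (j k : ℕ) : Prop :=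
  j < k ∧ k < ts.length ∧ tidAt ts j = tidAt ts k

/-- Release-acquire relation on trace positions: a release of `l` is related to
the next subsequent acquire of `l`. -/
def RelAcq (ts : List (GStmt P)) (j k : ℕ) : Prop :=
  ∃ l : P.Lock, j < k ∧ stmtIs ts j (·.isReleaseOn l) ∧ stmtIs ts k (·.isAcquireOn l) ∧
    ∀ m, j < m → m < k → ¬ stmtIs ts m (·.isAcquireOn l)

/-- The barrier epoch of the event at position `k`: the number of barrier-exit
events of the same thread at positions `≤ k`. -/
noncomputable def epoch (ts : List (GStmt P)) (k : ℕ) : ℕ :=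
  Set.ncard {m : ℕ | m ≤ k ∧ tidAt ts m = tidAt ts k ∧ stmtIs ts m (·.isExit)}

/-- Barrier relation on trace positions: earlier epochs happen before later ones. -/
def BarrierRel (ts : List (GStmt P)) (j k : ℕ) : Prop :=
  j < ts.length ∧ k < ts.length ∧ epoch ts j < epoch ts k

/-- The happens-before relation on trace positions. -/
def HB (ts : List (GStmt P)) : ℕ → ℕ → Prop :=
  Relation.TransGen (fun j k => IntraThread ts j k ∨ RelAcq ts j k ∨ BarrierRel ts j k)

/-- `C` is a conflict relation for `P`: symmetric, relating only nsync statements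
from different threads, and non-conflicting nsync statements from different
threads commute whenever both are enabled. -/
structure IsConflictRel (P : Program) (C : GStmt P → GStmt P → Prop) : Prop where
  symm : ∀ t1 t2, C t1 t2 → C t2 t1
  nsync_left : ∀ t1 t2, C t1 t2 → t1.isNsync
  nsync_right : ∀ t1 t2, C t1 t2 → t2.isNsync
  diff : ∀ t1 t2, C t1 t2 → t1.1 ≠ t2.1
  commute : ∀ t1 t2, t1.isNsync → t2.isNsync → t1.1 ≠ t2.1 → ¬ C t1 t2 →
    ∀ s : GState P, Enabled s t1 → Enabled s t2 →
      execute (execute s t1) t2 = execute (execute s t2) t1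

/-- The events at positions `j` and `k` race: their statements conflict and the
positions are unordered by happens-before. -/
def Races (C : GStmt P → GStmt P → Prop) (ts : List (GStmt P)) (j k : ℕ) : Prop :=
  (∃ t1 t2, ts[j]? = some t1 ∧ ts[k]? = some t2 ∧ C t1 t2) ∧ ¬ HB ts j k ∧ ¬ HB ts k j

/-- The trace contains a data race. -/
def HasRace (C : GStmt P → GStmt P → Prop) (ts : List (GStmt P)) : Prop :=
  ∃ j k, Races C ts j k

/-- The event (statement with per-thread occurrence number) at position `k`. -/
def eventAt (ts : List (GStmt P)) (k : ℕ) : Option (GStmt P × ℕ) :=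
  (ts[k]?).map (fun t => (t, (ts.take (k+1)).countP (fun t' => decide (t'.1 = t.1))))

/-- The set of events of a trace. -/
def events (ts : List (GStmt P)) : Set (GStmt P × ℕ) :=
  {e | ∃ k, eventAt ts k = some e}

/-! ### The race-detecting state graph -/

/-- The edge relation of the local graph of thread `i`. -/
def isLocalStep (i : Fin P.n) (σ σ' : P.Local i) : Prop :=
  match P.kind i σ with
  | .nsync => ∃ m ζ, m ∈ P.stmts i σ ∧ (P.update i σ m ζ).1 = σ'
  | .term => False
  | _ => σ' = P.next i σ

/-- Choice of sets `R i` containing all acquire and release local states and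
meeting every cycle of the local graph of thread `i`. -/
structure RSets (P : Program) where
  R : ∀ i, Set (P.Local i)
  acq_mem : ∀ i σ l, P.kind i σ = LKind.acquire l → σ ∈ R i
  rel_mem : ∀ i σ l, P.kind i σ = LKind.release l → σ ∈ R i
  acyclic : ∀ i σ, σ ∉ R i →
    ¬ Relation.TransGen (fun a b => a ∉ R i ∧ b ∉ R i ∧ isLocalStep i a b) σ σ

/-- Thread `i` is normal at state `s`: its local state is not in `R i` and it
has an enabled statement. -/
def Normal (RS : RSets P) (s : GState P) (i : Fin P.n) : Prop :=
  s.loc i ∉ RS.R i ∧ ∃ st : Stmt P.Lock (P.NStmt i), Enabled s ⟨i, st⟩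

/-- A node of the race-detecting state graph: a state together with, for each
thread, the set of nsync statements recorded since its last synchronization. -/
structure RNode (P : Program) where
  st : GState P
  hist : ∀ i, Set (P.NStmt i)

/-- Edge relation of the race-detecting state graph. -/
def REdge (RS : RSets P) (u : RNode P) (t : GStmt P) (v : RNode P) : Prop :=
  Enabled u.st t ∧ v.st = execute u.st t ∧
  (∀ m, t.2 = Stmt.nsync m → v.hist t.1 = insert m (u.hist t.1)) ∧
  (¬ t.isNsync →
    ((t.isExitZero ∨ u.st.loc t.1 ∈ RS.R t.1) → v.hist t.1 = ∅) ∧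
    (¬ (t.isExitZero ∨ u.st.loc t.1 ∈ RS.R t.1) → v.hist t.1 = u.hist t.1)) ∧
  (∀ i, i ≠ t.1 →
    (t.isExitZero → v.hist i = ∅) ∧ (¬ t.isExitZero → v.hist i = u.hist i)) ∧
  ((∃ i, Normal RS u.st i) → Normal RS u.st t.1 ∧ ∀ j, Normal RS u.st j → t.1 ≤ j)

/-- Paths in the race-detecting state graph. -/
inductive RPath (RS : RSets P) : RNode P → List (GStmt P) → RNode P → Prop
  | nil (u : RNode P) : RPath RS u [] u
  | cons {u v w : RNode P} {t : GStmt P} {l : List (GStmt P)} :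
      REdge RS u t v → RPath RS v l w → RPath RS u (t :: l) w

/-- Reachability in the race-detecting state graph. -/
def RReach (RS : RSets P) (u v : RNode P) : Prop := ∃ l, RPath RS u l v

/-- Thread `i` detects a race at node `u`. -/
def ThreadDetects (C : GStmt P → GStmt P → Prop) (u : RNode P) (i : Fin P.n) : Prop :=
  ∃ j, j ≠ i ∧ ∃ m1 ∈ u.hist i, ∃ m2 ∈ u.hist j,
    C ⟨i, Stmt.nsync m1⟩ ⟨j, Stmt.nsync m2⟩

/-- The edge `(u,t,v)` detects a race: the moving thread arrives at an `R i`,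
barrier, or terminal local state and detects a race at the target node. -/
def EdgeDetects (RS : RSets P) (C : GStmt P → GStmt P → Prop)
    (u : RNode P) (t : GStmt P) (v : RNode P) : Prop :=
  REdge RS u t v ∧
  (v.st.loc t.1 ∈ RS.R t.1 ∨ (P.kind t.1 (v.st.loc t.1)).isBarrier = true ∨
    (P.kind t.1 (v.st.loc t.1)).isTerm = true) ∧
  ThreadDetects C v t.1

/-- The race-detecting state graph detects a race from `u0`. -/
def DetectsFrom (RS : RSets P) (C : GStmt P → GStmt P → Prop) (u0 : RNode P) : Prop :=
  ∃ u t v, RReach RS u0 u ∧ EdgeDetects RS C u t v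

/-- The initial node for state `s0`: all recorded sets empty. -/
def initNode (s0 : GState P) : RNode P := ⟨s0, fun _ => ∅⟩

/-! ### Abstract state graphs and density -/

/-- A state graph of `P`. -/
structure StateGraph (P : Program) where
  V : Type
  edge : V → GStmt P → V → Prop
  stateOf : V → GState P
  edge_enabled : ∀ {u t v}, edge u t v → Enabled (stateOf u) t
  edge_exec : ∀ {u t v}, edge u t v → stateOf v = execute (stateOf u) t
  edge_det : ∀ {u t v v'}, edge u t v → edge u t v' → v = v'

/-- The ample set of a node: the labels of its outgoing edges. -/
def StateGraph.ample (G : StateGraph P) (u : G.V) : Set (GStmt P) :=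
  {t | ∃ v, G.edge u t v}

/-- Paths in a state graph. -/
inductive GPath (G : StateGraph P) : G.V → List (GStmt P) → G.V → Prop
  | nil (u : G.V) : GPath G u [] u
  | cons {u v w : G.V} {t : GStmt P} {l : List (GStmt P)} :
      G.edge u t v → GPath G v l w → GPath G u (t :: l) w

/-- Density of a state graph (the four ample-set conditions). -/
def StateGraph.IsDense (G : StateGraph P) : Prop :=
  (∀ u, (∃ t, Enabled (G.stateOf u) t) → (G.ample u).Nonempty) ∧
  (∀ u t t', t ∈ G.ample u → Enabled (G.stateOf u) t' → t'.1 = t.1 → t' ∈ G.ample u) ∧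
  (∀ u, G.ample u ≠ {t | Enabled (G.stateOf u) t} → ∀ t ∈ G.ample u, t.isNsync) ∧
  (∀ u l, l ≠ [] → GPath G u l u →
    ∃ v l1 l2, l = l1 ++ l2 ∧ GPath G u l1 v ∧
      G.ample v = {t | Enabled (G.stateOf v) t})

/-! ### Paths as functions and block decompositions -/

/-- A path in the race-detecting state graph presented as a node function `f`
along a statement list `ts`. -/
def IsPathFn (RS : RSets P) (f : ℕ → RNode P) (ts : List (GStmt P)) : Prop :=
  ∀ k (h : k < ts.length), REdge RS (f k) (ts.get ⟨k, h⟩) (f (k+1))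

/-- The statement at position `m` continues the block started at position `b`:
it is from the same thread and that thread is normal at the node it executes from. -/
def SameBlockStep (RS : RSets P) (f : ℕ → RNode P) (ts : List (GStmt P)) (b m : ℕ) : Prop :=
  tidAt ts m = tidAt ts b ∧ ∃ t, ts[m]? = some t ∧ Normal RS (f m).st t.1

/-- `c 0 = 0 < c 1 < ⋯ < c N = |ts|` is the block decomposition of the path
`(f, ts)`: block `j` covers positions `[c j, c (j+1))`. -/
structure IsBlockDecomp (RS : RSets P) (f : ℕ → RNode P) (ts : List (GStmt P))
    (N : ℕ) (c : ℕ → ℕ) : Prop where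
  zero : c 0 = 0
  last : c N = ts.length
  mono : ∀ j, j < N → c j < c (j+1)
  inside : ∀ j, j < N → ∀ m, c j < m → m < c (j+1) → SameBlockStep RS f ts (c j) m
  boundary : ∀ j, j < N → c (j+1) < ts.length → ¬ SameBlockStep RS f ts (c j) (c (j+1))

/-- Block `j` is initial: its thread is normal at its starting node. -/
def BlockInitial (RS : RSets P) (f : ℕ → RNode P) (ts : List (GStmt P))
    (c : ℕ → ℕ) (j : ℕ) : Prop :=
  ∃ t, ts[c j]? = some t ∧ Normal RS (f (c j)).st t.1

/-- Block `j` is complete: its thread is not normal at its final node. -/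
def BlockComplete (RS : RSets P) (f : ℕ → RNode P) (ts : List (GStmt P))
    (c : ℕ → ℕ) (j : ℕ) : Prop :=
  ∀ t, ts[c j]? = some t → ¬ Normal RS (f (c (j+1))).st t.1

/-- The position permutation induced by transposing the adjacent segments
`[a,b)` and `[b,d)`. -/
def segSwap (a b d m : ℕ) : ℕ :=
  if m < a then m else if m < b then m + (d - b) else if m < d then m - (b - a) else m

/-- The position permutation induced by transposing positions `p` and `p+1`. -/
def posSwap (p m : ℕ) : ℕ :=
  if m = p then p + 1 else if m = p + 1 then p else m

def NoExit (ts : List (GStmt P)) : Prop := ∀ t ∈ ts, ¬ t.isExit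

theorem epoch_zero {ts : List (GStmt P)} (h : NoExit ts) (k : ℕ) : epoch ts k = 0 := by
  unfold epoch
  have : {m : ℕ | m ≤ k ∧ tidAt ts m = tidAt ts k ∧ stmtIs ts m (·.isExit)} = ∅ := by
    ext m
    simp only [Set.mem_setOf_eq, Set.mem_empty_iff_false, iff_false]
    rintro ⟨_, _, t, ht, he⟩
    exact h t (List.mem_of_getElem? ht) he
  rw [this, Set.ncard_empty]

theorem no_bar {ts : List (GStmt P)} (h : NoExit ts) (j k : ℕ) : ¬ BarrierRel ts j k := by
  rintro ⟨_, _, h3⟩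
  rw [epoch_zero h, epoch_zero h] at h3
  omega

theorem hb_lt {ts : List (GStmt P)} (h : NoExit ts) {j k : ℕ} (hb : HB ts j k) : j < k := by
  have key : ∀ j k, (IntraThread ts j k ∨ RelAcq ts j k ∨ BarrierRel ts j k) → j < k := by
    rintro j k (h1 | ⟨_, h1, _⟩ | h1)
    · exact h1.1
    · exact h1
    · exact absurd h1 (no_bar h j k)
  induction hb with
  | single h1 => exact key _ _ h1
  | tail _ h1 ih => exact lt_trans ih (key _ _ h1)

theorem race_new {C : GStmt P → GStmt P → Prop} (l a : List (GStmt P)) (t x : GStmt P)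
    (hne : NoExit (l ++ t :: (a ++ [x]))) (ha : ∀ y ∈ a, y.1 ≠ t.1) (hx : x.1 ≠ t.1)
    (hn : t.isNsync) (hc : C t x) : HasRace C (l ++ t :: (a ++ [x])) := by
  have ht : (l ++ t :: (a ++ [x]))[l.length]? = some t := by simp
  refine ⟨l.length, l.length + 1 + a.length, ⟨t, x, ht, ?_, hc⟩, ?_, ?_⟩
  · rw [List.getElem?_append_right (by omega)]
    have : l.length + 1 + a.length - l.length = a.length + 1 := by omega
    rw [this]; simp
  · intro hb
    obtain ⟨m, hm, -⟩ := Relation.TransGen.head'_iff.1 hb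
    rcases hm with ⟨h1, h2, h3⟩ | ⟨lk, h1, ⟨t', h2, h3⟩, _⟩ | h1
    · unfold tidAt at h3
      rw [ht, List.getElem?_append_right (by omega)] at h3
      obtain ⟨d, rfl⟩ := Nat.exists_eq_add_of_lt h1
      have : l.length + d + 1 - l.length = d + 1 := by omega
      rw [this, List.getElem?_cons_succ] at h3
      simp only [Option.map_some] at h3
      obtain ⟨y, hy, hy'⟩ := Option.map_eq_some_iff.1 h3.symm
      have := List.mem_of_getElem? hy
      simp only [List.mem_append, List.mem_singleton] at this
      rcases this with h | rfl
      · exact ha y h hy'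
      · exact hx hy'
    · rw [ht] at h2
      obtain rfl := Option.some.inj h2
      obtain ⟨m, hm⟩ := hn
      unfold GStmt.isReleaseOn at h3
      rw [hm] at h3; cases h3
    · exact no_bar hne _ _ h1
  · intro hb
    have := hb_lt hne hb
    omega

theorem race_append {C : GStmt P → GStmt P → Prop} (l : List (GStmt P)) (t : GStmt P)
    (hne : NoExit (l ++ [t])) (h : HasRace C l) : HasRace C (l ++ [t]) := by
  obtain ⟨j, k, ⟨t1, t2, h1, h2, hc⟩, hjk, hkj⟩ := h
  have lt1 : j < l.length := (List.getElem?_eq_some_iff.1 h1).1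
  have lt2 : k < l.length := (List.getElem?_eq_some_iff.1 h2).1
  have e : ∀ m, m < l.length → (l ++ [t])[m]? = l[m]? := fun m hm => List.getElem?_append_left hm
  have key : ∀ a b, HB (l ++ [t]) a b → b < l.length → HB l a b := by
    intro a b hb
    induction hb using Relation.TransGen.head_induction_on with
    | single hs => 
      intro hb
      refine Relation.TransGen.single ?_
      rename_i a
      have := hb_lt hne (Relation.TransGen.single hs)
      rcases hs with ⟨h1, h2, h3⟩ | ⟨lk, h1, ⟨t1, h2, h2'⟩, ⟨t2, h3, h3'⟩, h4⟩ | h1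
      · left
        refine ⟨h1, hb, ?_⟩
        unfold tidAt at h3 ⊢
        rwa [e _ (by omega), e _ (by omega)] at h3
      · right; left
        rw [e _ (by omega)] at h2 h3
        refine ⟨lk, h1, ⟨t1, h2, h2'⟩, ⟨t2, h3, h3'⟩, ?_⟩
        rintro m hm1 hm2 ⟨t', hm3, hm4⟩
        exact h4 m hm1 hm2 ⟨t', by rw [e _ (by omega)]; exact hm3, hm4⟩
      · exact absurd h1 (no_bar hne _ _)
    | head hs hr ih =>
      intro hb
      refine Relation.TransGen.head ?_ (ih hb)
      rename_i a c
      have := hb_lt hne (Relation.TransGen.single hs)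
      have := hb_lt hne hr
      rcases hs with ⟨h1, h2, h3⟩ | ⟨lk, h1, ⟨t1, h2, h2'⟩, ⟨t2, h3, h3'⟩, h4⟩ | h1
      · left
        refine ⟨h1, by omega, ?_⟩
        unfold tidAt at h3 ⊢
        rwa [e _ (by omega), e _ (by omega)] at h3
      · right; left
        rw [e _ (by omega)] at h2 h3
        refine ⟨lk, h1, ⟨t1, h2, h2'⟩, ⟨t2, h3, h3'⟩, ?_⟩
        rintro m hm1 hm2 ⟨t', hm3, hm4⟩
        exact h4 m hm1 hm2 ⟨t', by rw [e _ (by omega)]; exact hm3, hm4⟩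
      · exact absurd h1 (no_bar hne _ _)
  refine ⟨j, k, ⟨t1, t2, by rw [e _ lt1]; exact h1, by rw [e _ lt2]; exact h2, hc⟩, ?_, ?_⟩
  · exact fun h => hjk (key _ _ h lt2)
  · exact fun h => hkj (key _ _ h lt1)

theorem posSwap_invol (p m : ℕ) : posSwap p (posSwap p m) = m := by
  unfold posSwap; grind

theorem swap_get (l b : List (GStmt P)) (x t : GStmt P) (m : ℕ) :
    (l ++ x :: t :: b)[posSwap l.length m]? = (l ++ t :: x :: b)[m]? := by
  unfold posSwap
  split_ifs with h1 h2
  · subst h1; simp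
  · subst h2; simp
  · rcases lt_or_ge m l.length with h | h
    · rw [List.getElem?_append_left h, List.getElem?_append_left h]
    · rw [List.getElem?_append_right h, List.getElem?_append_right h]
      obtain ⟨d, hd⟩ : ∃ d, m - l.length = d + 2 := ⟨m - l.length - 2, by omega⟩
      rw [hd]; simp

theorem race_swap {C : GStmt P → GStmt P → Prop} (l b : List (GStmt P)) (x t : GStmt P)
    (hne : NoExit (l ++ t :: x :: b)) (hx : x.1 ≠ t.1)
    (hn : t.isNsync) (h : HasRace C (l ++ x :: t :: b)) : HasRace C (l ++ t :: x :: b) := by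
  have g := swap_get l b x t
  have e0 : (l ++ t :: x :: b)[l.length]? = some t := by simp
  have e1 : (l ++ t :: x :: b)[l.length+1]? = some x := by simp
  have f1 : (l ++ x :: t :: b)[l.length+1]? = some t := by simp
  have nA : ∀ lk, ¬ t.isAcquireOn lk := by
    intro lk h; obtain ⟨m, hm⟩ := hn; unfold GStmt.isAcquireOn at h; rw [hm] at h; cases h
  have nR : ∀ lk, ¬ t.isReleaseOn lk := by
    intro lk h; obtain ⟨m, hm⟩ := hn; unfold GStmt.isReleaseOn at h; rw [hm] at h; cases h
  have hlen : (l ++ x :: t :: b).length = (l ++ t :: x :: b).length := by simp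
  have hlen2 : (l ++ t :: x :: b).length = l.length + b.length + 2 := by simp; omega
  have key : ∀ j k, HB (l ++ t :: x :: b) j k →
      HB (l ++ x :: t :: b) (posSwap l.length j) (posSwap l.length k) := by
    intro j k hb
    refine Relation.TransGen.lift (posSwap l.length) ?_ _ _ hb
    rintro j k (⟨h1, h2, h3⟩ | ⟨lk, h1, ⟨t1, h2, h2'⟩, ⟨t2, h3, h3'⟩, h4⟩ | h1)
    · left
      have hnot : ¬ (j = l.length ∧ k = l.length + 1) := by
        rintro ⟨rfl, rfl⟩
        unfold tidAt at h3
        rw [e0, e1] at h3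
        exact hx (Option.some.inj h3).symm
      refine ⟨?_, ?_, ?_⟩
      · unfold posSwap; split_ifs <;> omega
      · rw [hlen]; unfold posSwap; split_ifs <;> omega
      · unfold tidAt at h3 ⊢
        rw [g, g]; exact h3
    · right; left
      have hj : j ≠ l.length := by
        rintro rfl; rw [e0] at h2; obtain rfl := Option.some.inj h2; exact nR _ h2'
      have hk : k ≠ l.length := by
        rintro rfl; rw [e0] at h3; obtain rfl := Option.some.inj h3; exact nA _ h3'
      refine ⟨lk, ?_, ⟨t1, by rw [g]; exact h2, h2'⟩, ⟨t2, by rw [g]; exact h3, h3'⟩, ?_⟩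
      · unfold posSwap; split_ifs <;> omega
      · rintro m hm1 hm2 ⟨t', hm3, hm4⟩
        have hm : m ≠ l.length + 1 := by
          rintro rfl; rw [f1] at hm3; obtain rfl := Option.some.inj hm3; exact nA _ hm4
        refine h4 (posSwap l.length m) ?_ ?_ ⟨t', ?_, hm4⟩
        · unfold posSwap at hm1 ⊢; split_ifs at hm1 ⊢ <;> omega
        · unfold posSwap at hm2 ⊢; split_ifs at hm2 ⊢ <;> omega
        · rw [← g, posSwap_invol]; exact hm3
    · exact absurd h1 (no_bar hne _ _)
  obtain ⟨j, k, ⟨t1, t2, h1, h2, hc⟩, hjk, hkj⟩ := h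
  refine ⟨posSwap l.length j, posSwap l.length k,
    ⟨t1, t2, by rw [← g, posSwap_invol]; exact h1, by rw [← g, posSwap_invol]; exact h2, hc⟩, ?_, ?_⟩
  · intro h; have := key _ _ h; rw [posSwap_invol, posSwap_invol] at this; exact hjk this
  · intro h; have := key _ _ h; rw [posSwap_invol, posSwap_invol] at this; exact hkj this

theorem race_move {C : GStmt P → GStmt P → Prop} (a : List (GStmt P)) (t : GStmt P)
    (hn : t.isNsync) : ∀ (l b : List (GStmt P)), NoExit (l ++ t :: (a ++ b)) →
    (∀ y ∈ a, y.1 ≠ t.1) →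
    HasRace C (l ++ (a ++ t :: b)) → HasRace C (l ++ t :: (a ++ b)) := by
  induction a with
  | nil => intro l b _ _ h; exact h
  | cons x a ih =>
    intro l b hne ha h
    have := ih (l ++ [x]) b (by intro y hy; apply hne; simp at hy ⊢; tauto)
      (fun y hy => ha y (List.mem_cons_of_mem _ hy)) (by simpa using h)
    exact race_swap l (a ++ b) x t hne (ha x (by simp)) hn (by simpa using this)

theorem exec_loc_ne (s : GState P) (t : GStmt P) (j : Fin P.n) (h : j ≠ t.1) :
    (execute s t).loc j = s.loc j := by
  obtain ⟨i, st⟩ := t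
  simp only [execute]
  exact Function.update_of_ne h _ _

theorem exec_lk (s : GState P) (t : GStmt P) (h : t.isNsync) : (execute s t).lk = s.lk := by
  obtain ⟨i, st⟩ := t
  obtain ⟨m, hm⟩ := h
  change st = _ at hm
  rw [hm]
  rfl

theorem exec_wait (hnb : NoBarriers P) (s : GState P) (t : GStmt P) :
    (execute s t).wait = s.wait := by
  obtain ⟨i, st⟩ := t
  have : ∀ i σ, (P.kind i σ).isBarrier = false := by
    intro i σ
    have := hnb i σ
    cases h : P.kind i σ <;> simp_all [LKind.isBarrier]
  simp only [execute, this]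
  rfl

theorem enabled_stay (hnb : NoBarriers P) {s : GState P} {t x : GStmt P} (hx : x.1 ≠ t.1)
    (hn : t.isNsync) (h : Enabled s x) : Enabled (execute s t) x := by
  have h1 := exec_loc_ne s t x.1 hx
  have h2 := exec_lk s t hn
  have h3 := exec_wait hnb s t
  obtain ⟨j, st⟩ := x
  simp only at h1
  unfold Enabled at h ⊢
  simp only [h1, h2, h3]
  exact h

/-- An nsync-enabled statement means the kind is nsync. -/
theorem enabled_nsync {s : GState P} {t : GStmt P} (h : Enabled s t) :
    t.isNsync ↔ P.kind t.1 (s.loc t.1) = .nsync := by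
  obtain ⟨i, st⟩ := t
  unfold GStmt.isNsync
  unfold Enabled at h
  cases hk : P.kind i (s.loc i) <;> cases st <;> simp_all

theorem enabled_loc {s s' : GState P} {t : GStmt P} (hn : t.isNsync) (hl : s'.loc t.1 = s.loc t.1)
    (h : Enabled s t) : Enabled s' t := by
  obtain ⟨i, st⟩ := t
  obtain ⟨m, hm⟩ := hn
  change st = _ at hm
  simp only at hl
  rw [hm] at h ⊢
  unfold Enabled at h ⊢
  simp only [hl]
  cases hk : P.kind i (s.loc i) <;> simp_all

theorem not_exit (hnb : NoBarriers P) {s : GState P} {t : GStmt P} (h : Enabled s t) :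
    ¬ t.isExit := by
  obtain ⟨i, st⟩ := t
  intro he
  unfold GStmt.isExit at he
  simp only at he
  subst he
  have := hnb i (s.loc i)
  unfold Enabled at h
  cases hk : P.kind i (s.loc i) <;> simp_all

theorem commute (hnb : NoBarriers P) {C : GStmt P → GStmt P → Prop} (hC : IsConflictRel P C)
    {s : GState P} {t x : GStmt P} (hx : x.1 ≠ t.1)
    (hn : t.isNsync) (ht : Enabled s t) (h : Enabled s x) (hc : ¬ C t x) :
    execute (execute s t) x = execute (execute s x) t := by
  by_cases hxn : x.isNsync
  · exact hC.commute t x hn hxn hx.symm hc s ht h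
  · have hw : (execute (execute s t) x).wait = (execute (execute s x) t).wait := by
      simp only [exec_wait hnb]
    obtain ⟨i, st⟩ := t
    obtain ⟨j, sx⟩ := x
    obtain ⟨m, hm⟩ := hn
    change st = _ at hm
    simp only at hx
    clear hC hc ht h
    rw [hm] at hw ⊢
    cases hA : execute (execute s ⟨i, .nsync m⟩) ⟨j, sx⟩
    cases hB : execute (execute s ⟨j, sx⟩) ⟨i, .nsync m⟩
    rw [hA, hB] at hw
    simp only at hw
    cases sx with
    | nsync m' => exact absurd ⟨m', rfl⟩ hxn
    | _ =>
      simp only [execute, GState.mk.injEq] at hA hB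
      simp only [Function.update_of_ne hx, Function.update_of_ne hx.symm] at hA hB
      obtain ⟨a1, a2, a3, -⟩ := hA
      obtain ⟨b1, b2, b3, -⟩ := hB
      rw [GState.mk.injEq]
      refine ⟨?_, ?_, ?_, hw⟩
      · rw [← a1, ← b1]; exact Function.update_comm hx.symm _ _ _
      · rw [← a2, ← b2]
      · rw [← a3, ← b3]

theorem exec_append {s s' sf : GState P} {a b : List (GStmt P)} (h1 : Exec s a s')
    (h2 : Exec s' b sf) : Exec s (a ++ b) sf := by
  induction h1 with
  | nil => exact h2
  | cons he hx _ ih => exact .cons he hx (ih h2)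

theorem exec_split {b : List (GStmt P)} {sf : GState P} : ∀ {a : List (GStmt P)} {s : GState P},
    Exec s (a ++ b) sf → ∃ s', Exec s a s' ∧ Exec s' b sf := by
  intro a
  induction a with
  | nil => intro s h; exact ⟨s, .nil s, h⟩
  | cons x a ih =>
    intro s h
    cases h with
    | cons he hx hr =>
      obtain ⟨s', h1, h2⟩ := ih hr
      exact ⟨s', .cons he hx h1, h2⟩

theorem exec_noexit (hnb : NoBarriers P) {s sf : GState P} {a : List (GStmt P)}
    (h : Exec s a sf) : NoExit a := by
  induction h with
  | nil => intro t ht; simp at ht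
  | cons he _ _ ih =>
    intro t ht
    rcases List.mem_cons.1 ht with rfl | ht
    · exact not_exit hnb he
    · exact ih t ht

theorem exec_free_loc {s sf : GState P} {a : List (GStmt P)} (i : Fin P.n)
    (h : Exec s a sf) (ha : ∀ y ∈ a, y.1 ≠ i) : sf.loc i = s.loc i := by
  induction h with
  | nil => rfl
  | cons he hx _ ih =>
    rw [ih (fun y hy => ha y (List.mem_cons_of_mem _ hy)), ← hx]
    exact exec_loc_ne _ _ _ (ha _ (by simp)).symm

theorem push (hnb : NoBarriers P) {C : GStmt P → GStmt P → Prop} (hC : IsConflictRel P C)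
    {t : GStmt P} (hn : t.isNsync) {s s' : GState P} {a : List (GStmt P)}
    (h : Exec s a s') : Enabled s t → (∀ y ∈ a, y.1 ≠ t.1) →
    Exec (execute s t) a (execute s' t) ∨
    ∃ a' x a'' sf, a = a' ++ x :: a'' ∧ C t x ∧ Exec (execute s t) (a' ++ [x]) sf := by
  induction h with
  | nil s => intro _ _; exact .inl (.nil _)
  | @cons s s1 sf x l he hx _ ih =>
    intro ht ha
    have hxt := ha x (by simp)
    have hex := enabled_stay hnb hxt hn he
    by_cases hc : C t x
    · exact .inr ⟨[], x, l, _, rfl, hc, .cons hex rfl (.nil _)⟩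
    · have hcm := commute hnb hC hxt hn ht he hc
      subst hx
      rcases ih (enabled_loc hn (exec_loc_ne _ _ _ hxt.symm) ht)
        (fun y hy => ha y (List.mem_cons_of_mem _ hy)) with h | ⟨a', x', a'', sf', rfl, h2, h3⟩
      · exact .inl (.cons hex hcm h)
      · exact .inr ⟨x :: a', x', a'', sf', rfl, h2, .cons hex hcm h3⟩

theorem step (hnb : NoBarriers P) {C : GStmt P → GStmt P → Prop} (hC : IsConflictRel P C)
    {t : GStmt P} (hn : t.isNsync) {s s' sf : GState P} {l a b r : List (GStmt P)}
    (hl : NoExit l) (ht : Enabled s t) (ha : ∀ y ∈ a, y.1 ≠ t.1)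
    (h1 : Exec s a s') (h2 : Exec (execute s' t) b sf)
    (hr : HasRace C (l ++ (a ++ t :: b))) (hlen : a.length + b.length ≤ r.length) :
    ∃ ts' sf', ts'.length ≤ r.length ∧ Exec (execute s t) ts' sf' ∧
      HasRace C (l ++ t :: ts') := by
  have hne : ∀ c s1, Exec (execute s t) c s1 → NoExit (l ++ t :: c) := by
    intro c s1 hc y hy
    rcases List.mem_append.1 hy with h | h
    · exact hl y h
    · exact exec_noexit hnb (.cons ht rfl hc) y h
  rcases push hnb hC hn h1 ht ha with h | ⟨a', x, a'', sf', rfl, hc, h3⟩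
  · have he := exec_append h h2
    exact ⟨a ++ b, sf, by simpa using hlen, he, race_move a t hn l b (hne _ _ he) ha hr⟩
  · refine ⟨a' ++ [x], sf', ?_, h3, ?_⟩
    · simp at hlen ⊢; omega
    · exact race_new l a' t x (hne _ _ h3) (fun y hy => ha y (by simp [hy])) (ha x (by simp)) hn hc

theorem gpath_append {G : StateGraph P} {u v w : G.V} {a b : List (GStmt P)} (h1 : GPath G u a v)
    (h2 : GPath G v b w) : GPath G u (a ++ b) w := by
  induction h1 with
  | nil => exact h2
  | cons he _ ih => exact .cons he (ih h2)

theorem gpath_noexit (hnb : NoBarriers P) {G : StateGraph P} {u v : G.V} {a : List (GStmt P)}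
    (h : GPath G u a v) : NoExit a := by
  induction h with
  | nil => intro t ht; simp at ht
  | cons he _ ih =>
    intro t ht
    rcases List.mem_cons.1 ht with rfl | ht
    · exact not_exit hnb (G.edge_enabled he)
    · exact ih t ht

def Full (G : StateGraph P) (v : G.V) : Prop := G.ample v = {t | Enabled (G.stateOf v) t}

def Below (G : StateGraph P) (v u : G.V) : Prop := ¬ Full G u ∧ ∃ t, G.edge u t v

theorem below_path {G : StateGraph P} {u v : G.V} (h : Relation.TransGen (Function.swap (Below G)) u v) :
    ∃ l, l ≠ [] ∧ GPath G u l v ∧ ∀ l1 l2 w, l = l1 ++ l2 → GPath G u l1 w → ¬ Full G w ∨ w = v := by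
  induction h using Relation.TransGen.head_induction_on with
  | single hs =>
    obtain ⟨hf, t, he⟩ := hs
    refine ⟨[t], by simp, .cons he (.nil _), ?_⟩
    intro l1 l2 w hl hp
    cases hp with
    | nil => exact .inl hf
    | cons he' hp' =>
      simp only [List.cons_append, List.cons.injEq] at hl
      obtain ⟨rfl, hl⟩ := hl
      have := G.edge_det he he'
      subst this
      cases hp' with
      | nil => exact .inr rfl
      | cons => simp at hl
  | head hs _ ih =>
    obtain ⟨hf, t, he⟩ := hs
    obtain ⟨l, -, hp, hl⟩ := ih
    refine ⟨t :: l, by simp, .cons he hp, ?_⟩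
    intro l1 l2 w hl' hp'
    cases hp' with
    | nil => exact .inl hf
    | cons he' hp' =>
      simp only [List.cons_append, List.cons.injEq] at hl'
      obtain ⟨rfl, hl'⟩ := hl'
      have := G.edge_det he he'
      subst this
      exact hl _ _ _ hl' hp'

theorem below_irrefl {G : StateGraph P} (hd : G.IsDense) (u : G.V) :
    ¬ Relation.TransGen (Below G) u u := by
  intro h
  have h' := Relation.transGen_swap.2 h
  obtain ⟨w, ⟨hf, -⟩, -⟩ := Relation.TransGen.head'_iff.1 h'
  obtain ⟨l, hl, hp, hall⟩ := below_path h'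
  obtain ⟨v, l1, l2, e, hp1, hv⟩ := hd.2.2.2 u l hl hp
  rcases hall l1 l2 v e hp1 with h | rfl
  · exact h hv
  · exact hf hv

theorem below_wf {G : StateGraph P} (hd : G.IsDense) (u0 : G.V)
    (hfin : {v | ∃ l, GPath G u0 l v}.Finite) :
    WellFounded (fun a b : {v // ∃ l, GPath G u0 l v} => Relation.TransGen (Below G) a.1 b.1) := by
  have : Finite {v // ∃ l, GPath G u0 l v} := hfin
  have : IsTrans {v // ∃ l, GPath G u0 l v} (fun a b => Relation.TransGen (Below G) a.1 b.1) :=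
    ⟨fun _ _ _ h1 h2 => h1.trans h2⟩
  have : Std.Irrefl (fun a b : {v // ∃ l, GPath G u0 l v} => Relation.TransGen (Below G) a.1 b.1) :=
    ⟨fun a => below_irrefl hd a.1⟩
  exact Finite.wellFounded_of_trans_of_irrefl _

theorem main (hnb : NoBarriers P)
    {C : GStmt P → GStmt P → Prop} (hC : IsConflictRel P C)
    {G : StateGraph P} (hd : G.IsDense) (u0 : G.V)
    (hfin : {v | ∃ l, GPath G u0 l v}.Finite) : ∀ (n : ℕ) (u : {v // ∃ l, GPath G u0 l v})
    (l ts : List (GStmt P)) (sf : GState P), ts.length ≤ n → GPath G u0 l u.1 →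
    Exec (G.stateOf u.1) ts sf → HasRace C (l ++ ts) → ∃ l v, GPath G u0 l v ∧ HasRace C l := by
  intro n
  induction n with
  | zero =>
    intro u l ts sf hlen hp _ hr
    obtain rfl : ts = [] := List.length_eq_zero_iff.1 (by omega)
    exact ⟨l, u.1, hp, by simpa using hr⟩
  | succ n ihn =>
    intro u
    induction u using (below_wf hd u0 hfin).induction with
    | _ u ihu =>
    intro l ts sf hlen hp hex hr
    cases hex with
    | nil => exact ⟨l, u.1, hp, by simpa using hr⟩
    | @cons _ s1 _ t ts he hx hrest =>
      by_cases hf : Full G u.1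
      · have : t ∈ G.ample u.1 := by
          unfold Full at hf; rw [hf]; exact he
        obtain ⟨v, hv⟩ := this
        have hpv := gpath_append hp (.cons hv (.nil v))
        have hs := G.edge_exec hv
        refine ihn ⟨v, _, hpv⟩ (l ++ [t]) ts sf (by simpa using hlen) hpv ?_ (by simpa using hr)
        simp only [hs, hx]; exact hrest
      · have hex := Exec.cons he hx hrest
        obtain ⟨t0, ht0⟩ := hd.1 u.1 ⟨t, he⟩
        have hns := hd.2.2.1 u.1 hf
        have hen : ∀ t ∈ G.ample u.1, Enabled (G.stateOf u.1) t := by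
          rintro t ⟨v, hv⟩; exact G.edge_enabled hv
        have hk0 := (enabled_nsync (hen t0 ht0)).1 (hns t0 ht0)
        have hgoal : ∃ t' ∈ G.ample u.1, ∃ ts' sf', ts'.length ≤ (t :: ts).length ∧
            Exec (execute (G.stateOf u.1) t') ts' sf' ∧ HasRace C (l ++ t' :: ts') := by
          have hl := gpath_noexit hnb hp
          by_cases hocc : ∃ y ∈ t :: ts, y.1 = t0.1
          · obtain ⟨a, t', b, hsplit, ht', ha⟩ : ∃ a t' b, t :: ts = a ++ t' :: b ∧ t'.1 = t0.1 ∧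
                ∀ y ∈ a, y.1 ≠ t0.1 := by
              generalize t :: ts = L at hocc
              clear * - hocc
              induction L with
              | nil => simp at hocc
              | cons x L ih =>
                by_cases hx : x.1 = t0.1
                · exact ⟨[], x, L, rfl, hx, by simp⟩
                · obtain ⟨y, hy, hy'⟩ := hocc
                  rcases List.mem_cons.1 hy with rfl | hy
                  · exact absurd hy' hx
                  · obtain ⟨a, t', b, rfl, h1, h2⟩ := ih ⟨y, hy, hy'⟩
                    refine ⟨x :: a, t', b, rfl, h1, ?_⟩
                    intro z hz
                    rcases List.mem_cons.1 hz with rfl | hz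
                    · exact hx
                    · exact h2 z hz
            rw [hsplit] at hex hr
            obtain ⟨s', hx1, hx2⟩ := exec_split hex
            cases hx2 with
            | cons he' hx' hx2 =>
              subst hx'
              have hloc := exec_free_loc t'.1 hx1 (by rw [ht']; exact ha)
              have hn : t'.isNsync := by
                rw [enabled_nsync he', hloc, ht']; exact hk0
              have het : Enabled (G.stateOf u.1) t' := enabled_loc hn hloc.symm he'
              refine ⟨t', hd.2.1 u.1 t0 t' ht0 het ht', ?_⟩
              exact step hnb hC hn hl het (by rw [ht']; exact ha) hx1 hx2 hr
                (by rw [hsplit]; simp)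
          · push Not at hocc
            have hn := hns t0 ht0
            have hloc := exec_free_loc t0.1 hex hocc
            have he' : Enabled sf t0 := enabled_loc hn hloc (hen t0 ht0)
            refine ⟨t0, ht0, ?_⟩
            have hne : NoExit (l ++ (t :: ts) ++ [t0]) := by
              intro y hy
              rcases List.mem_append.1 hy with hy | hy
              · rcases List.mem_append.1 hy with hy | hy
                · exact hl y hy
                · exact exec_noexit hnb hex y hy
              · rw [List.mem_singleton.1 hy]; exact not_exit hnb he'
            have hr' := race_append _ t0 hne hr
            rw [List.append_assoc] at hr'
            exact step hnb hC hn hl (hen t0 ht0) hocc hex (.nil _) hr' (by simp)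
        obtain ⟨t', ⟨v, hv⟩, ts', sf', hlen', hex', hr'⟩ := hgoal
        have hpv := gpath_append hp (.cons hv (.nil v))
        have hs := G.edge_exec hv
        refine ihu ⟨v, _, hpv⟩ (.single ⟨hf, t', hv⟩) (l ++ [t']) ts' sf' (by omega) hpv ?_
          (by simpa using hr')
        simp only [hs]; exact hex'

/-- Reduction theorem, part 1: a dense state graph preserves the existence of
racy executions. -/
theorem stmt8 (P : Program) (hnb : NoBarriers P)
    (C : GStmt P → GStmt P → Prop) (hC : IsConflictRel P C)
    (G : StateGraph P) (hd : G.IsDense) (u0 : G.V)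
    (hfin : {v | ∃ l, GPath G u0 l v}.Finite)
    (h : ∃ ts sf, Exec (G.stateOf u0) ts sf ∧ HasRace C ts) :
    ∃ l v, GPath G u0 l v ∧ HasRace C l := by
  obtain ⟨ts, sf, hex, hr⟩ := h
  exact main hnb hC hd u0 hfin ts.length ⟨u0, [], .nil u0⟩ [] ts sf le_rfl (.nil u0) hex hr

end MC
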